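/- Let μ > 0 and ν ∈ ℝ, and let f_{μ,ν}(z) = (1/Γ(μ)) ∫₀^∞ e^{−tz} t^{μ−1} (1+t)^{−ν} dt for z > 0. Then, as z → 0+: (1) if μ < ν, then f_{μ,ν}(z) → Γ(ν−μ)/Γ(ν); (2) if μ > ν, then z^{μ−ν}·f_{μ,ν}(z) → Γ(μ−ν)/Γ(μ); (3) if μ = ν, then f_{μ,μ}(z)/(−log z) → 1/Γ(μ). -/

import Mathlib

open Filter

/-- `f μ ν z = Ψ(μ, μ+1-ν, z)`, the Tricomi confluent hypergeometric function,
given by its integral representation. -/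
noncomputable def tricomiF (μ ν z : ℝ) : ℝ :=
  (1 / Real.Gamma μ) * ∫ t in Set.Ioi (0:ℝ), Real.exp (-t * z) * t ^ (μ - 1) * (1 + t) ^ (-ν)

section BetaIntegral

open MeasureTheory Set

/-- The real Beta integral converges. -/
theorem integrableOn_rpow_mul_one_sub_rpow {a b : ℝ} (ha : 0 < a) (hb : 0 < b) :
    IntegrableOn (fun x : ℝ => x ^ (a - 1) * (1 - x) ^ (b - 1)) (Ioo 0 1) := by
  have h := Complex.betaIntegral_convergent (u := a) (v := b) (by simpa) (by simpa)
  rw [intervalIntegrable_iff_integrableOn_Ioo_of_le zero_le_one] at h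
  refine (Integrable.re h).congr (ae_restrict_of_forall_mem measurableSet_Ioo fun x hx => ?_)
  simp only [RCLike.re_to_complex]
  norm_cast
  rw [← Complex.ofReal_cpow hx.1.le, ← Complex.ofReal_cpow (by linarith [hx.2]),
    ← Complex.ofReal_mul, Complex.ofReal_re]

/-- Evaluation of the real Beta integral. -/
theorem integral_rpow_mul_one_sub_rpow {a b : ℝ} (ha : 0 < a) (hb : 0 < b) :
    ∫ x in Ioo (0 : ℝ) 1, x ^ (a - 1) * (1 - x) ^ (b - 1) =
      Real.Gamma a * Real.Gamma b / Real.Gamma (a + b) := by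
  have h := Complex.betaIntegral_convergent (u := a) (v := b) (by simpa) (by simpa)
  rw [intervalIntegrable_iff_integrableOn_Ioo_of_le zero_le_one] at h
  change _ = ProbabilityTheory.beta a b
  rw [ProbabilityTheory.beta_eq_betaIntegralReal a b ha hb, Complex.betaIntegral,
    intervalIntegral.integral_of_le zero_le_one, integral_Ioc_eq_integral_Ioo,
    ← RCLike.re_to_complex, ← integral_re h]
  refine setIntegral_congr_fun measurableSet_Ioo fun x hx => ?_
  simp only [RCLike.re_to_complex]
  norm_cast
  rw [← Complex.ofReal_cpow hx.1.le, ← Complex.ofReal_cpow (by linarith [hx.2]),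
    ← Complex.ofReal_mul, Complex.ofReal_re]

theorem image_div_one_sub_Ioo : (fun x : ℝ => x / (1 - x)) '' Ioo 0 1 = Ioi 0 := by
  ext t
  constructor
  · rintro ⟨x, hx, rfl⟩
    exact div_pos hx.1 (by linarith [hx.2])
  · intro (ht : 0 < t)
    refine ⟨t / (1 + t), ⟨by positivity, by rw [div_lt_one (by positivity)]; linarith⟩, ?_⟩
    have : 1 - t / (1 + t) = 1 / (1 + t) := by field_simp; ring
    simp only [this]
    field_simp

theorem injOn_div_one_sub_Ioo : InjOn (fun x : ℝ => x / (1 - x)) (Ioo 0 1) := by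
  intro x hx y hy h
  have hx' : 1 - x ≠ 0 := by linarith [hx.2]
  have hy' : 1 - y ≠ 0 := by linarith [hy.2]
  simp only [div_eq_div_iff hx' hy'] at h
  linarith

theorem hasDerivWithinAt_div_one_sub {x : ℝ} (hx : x ∈ Ioo (0 : ℝ) 1) :
    HasDerivWithinAt (fun x : ℝ => x / (1 - x)) (1 / (1 - x) ^ 2) (Ioo 0 1) x := by
  have hx' : 1 - x ≠ 0 := by linarith [hx.2]
  have h := ((hasDerivAt_id' x).fun_div ((hasDerivAt_id' x).const_sub 1) hx').hasDerivWithinAt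
    (s := Ioo 0 1)
  rwa [show 1 * (1 - x) - x * -1 = 1 by ring] at h

theorem abs_deriv_smul_div_one_sub (μ ν : ℝ) {x : ℝ} (hx : x ∈ Ioo (0 : ℝ) 1) :
    |1 / (1 - x) ^ 2| • ((x / (1 - x)) ^ (μ - 1) * (1 + x / (1 - x)) ^ (-ν)) =
      x ^ (μ - 1) * (1 - x) ^ (ν - μ - 1) := by
  have hy : 0 < 1 - x := by linarith [hx.2]
  have h1 : 1 + x / (1 - x) = (1 - x)⁻¹ := by field_simp; ring
  have h2 : (1 - x) ^ (ν - μ - 1) = (1 - x) ^ ν * ((1 - x) ^ (μ - 1))⁻¹ * ((1 - x) ^ 2)⁻¹ := by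
    rw [← Real.rpow_natCast, ← Real.rpow_neg hy.le, ← Real.rpow_neg hy.le, ← Real.rpow_add hy,
      ← Real.rpow_add hy]
    congr 1
    push_cast
    ring
  rw [abs_of_pos (by positivity), smul_eq_mul, h1, h2, Real.div_rpow hx.1.le hy.le,
    Real.inv_rpow hy.le, Real.rpow_neg hy.le, inv_inv]
  ring

/-- The Beta integral on `(0, ∞)` converges. -/
theorem integrableOn_rpow_mul_one_add_rpow {μ ν : ℝ} (hμ : 0 < μ) (h : μ < ν) :
    IntegrableOn (fun t : ℝ => t ^ (μ - 1) * (1 + t) ^ (-ν)) (Ioi 0) := by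
  rw [← image_div_one_sub_Ioo, integrableOn_image_iff_integrableOn_abs_deriv_smul measurableSet_Ioo
    (fun x hx => hasDerivWithinAt_div_one_sub hx) injOn_div_one_sub_Ioo,
    integrableOn_congr_fun (fun x hx => abs_deriv_smul_div_one_sub μ ν hx) measurableSet_Ioo]
  exact integrableOn_rpow_mul_one_sub_rpow hμ (sub_pos.2 h)

/-- Evaluation of the Beta integral on `(0, ∞)`. -/
theorem integral_rpow_mul_one_add_rpow {μ ν : ℝ} (hμ : 0 < μ) (h : μ < ν) :
    ∫ t in Ioi (0 : ℝ), t ^ (μ - 1) * (1 + t) ^ (-ν) =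
      Real.Gamma μ * Real.Gamma (ν - μ) / Real.Gamma ν := by
  rw [← image_div_one_sub_Ioo, integral_image_eq_integral_abs_deriv_smul measurableSet_Ioo
    (fun x hx => hasDerivWithinAt_div_one_sub hx) injOn_div_one_sub_Ioo,
    setIntegral_congr_fun measurableSet_Ioo (fun x hx => abs_deriv_smul_div_one_sub μ ν hx),
    integral_rpow_mul_one_sub_rpow hμ (sub_pos.2 h), add_sub_cancel]

end BetaIntegral

section Tricomi

open MeasureTheory Set Topology

theorem tendsto_tricomiF_of_lt {μ ν : ℝ} (hμ : 0 < μ) (h : μ < ν) :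
    Tendsto (fun z => tricomiF μ ν z) (𝓝[>] 0) (𝓝 (Real.Gamma (ν - μ) / Real.Gamma ν)) := by
  have hΓ := (Real.Gamma_pos_of_pos hμ).ne'
  have key : Tendsto (fun z : ℝ => ∫ t in Ioi (0:ℝ), Real.exp (-t * z) * t ^ (μ - 1) *
      (1 + t) ^ (-ν)) (𝓝[>] 0) (𝓝 (∫ t in Ioi (0:ℝ), t ^ (μ - 1) * (1 + t) ^ (-ν))) := by
    refine tendsto_integral_filter_of_dominated_convergence
      (fun t => t ^ (μ - 1) * (1 + t) ^ (-ν)) (Eventually.of_forall fun z => ?_) ?_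
      (integrableOn_rpow_mul_one_add_rpow hμ h) (Eventually.of_forall fun t => ?_)
    · exact Measurable.aestronglyMeasurable (by fun_prop)
    · filter_upwards [self_mem_nhdsWithin] with z (hz : 0 < z)
      refine ae_restrict_of_forall_mem measurableSet_Ioi fun t (ht : 0 < t) => ?_
      rw [Real.norm_of_nonneg (by positivity), mul_assoc]
      exact mul_le_of_le_one_left (by positivity) (Real.exp_le_one_iff.2 (by nlinarith))
    · have : Continuous fun z : ℝ => Real.exp (-t * z) * t ^ (μ - 1) * (1 + t) ^ (-ν) := by
        fun_prop
      simpa using (this.tendsto 0).mono_left nhdsWithin_le_nhds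
  have := key.const_mul (1 / Real.Gamma μ)
  rw [integral_rpow_mul_one_add_rpow hμ h] at this
  have hval : 1 / Real.Gamma μ * (Real.Gamma μ * Real.Gamma (ν - μ) / Real.Gamma ν) =
      Real.Gamma (ν - μ) / Real.Gamma ν := by field_simp
  rwa [hval] at this

/-- Rescaling the integral defining `tricomiF`. -/
theorem rpow_mul_tricomiF (μ ν : ℝ) {z : ℝ} (hz : 0 < z) :
    z ^ (μ - ν) * tricomiF μ ν z = (1 / Real.Gamma μ) *
      ∫ s in Ioi (0:ℝ), Real.exp (-s) * s ^ (μ - 1) * (z + s) ^ (-ν) := by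
  have h := integral_comp_mul_left_Ioi'
    (fun s : ℝ => Real.exp (-s) * s ^ (μ - 1) * (z + s) ^ (-ν)) 0 hz
  rw [mul_zero] at h
  rw [← h, tricomiF, mul_left_comm, smul_eq_mul]
  congr 1
  rw [← integral_const_mul, ← integral_const_mul]
  refine setIntegral_congr_fun measurableSet_Ioi fun t (ht : 0 < t) => ?_
  have h1 : z + z * t = z * (1 + t) := by ring
  have h2 : z ^ (μ - ν) = z * z ^ (μ - 1) * z ^ (-ν) := by
    nth_rw 2 [← Real.rpow_one z]
    rw [← Real.rpow_add hz, ← Real.rpow_add hz]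
    congr 1
    ring
  simp only [h1, h2]
  rw [Real.mul_rpow hz.le ht.le, Real.mul_rpow hz.le (by positivity), neg_mul, mul_comm t z]
  ring

theorem tendsto_rpow_mul_tricomiF_of_lt {μ ν : ℝ} (hμ : 0 < μ) (h : ν < μ) :
    Tendsto (fun z => z ^ (μ - ν) * tricomiF μ ν z) (𝓝[>] 0)
      (𝓝 (Real.Gamma (μ - ν) / Real.Gamma μ)) := by
  have hG (s : ℝ) (hs : s ∈ Ioi 0) : Real.exp (-s) * s ^ (μ - 1) * s ^ (-ν) =
      Real.exp (-s) * s ^ (μ - ν - 1) := by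
    rw [mul_assoc, ← Real.rpow_add (mem_Ioi.1 hs)]
    ring_nf
  have hint : IntegrableOn (fun s : ℝ => Real.exp (-s) * s ^ (μ - 1) * s ^ (-ν)) (Ioi 0) := by
    rw [integrableOn_congr_fun hG measurableSet_Ioi]
    exact Real.GammaIntegral_convergent (sub_pos.2 h)
  have key : Tendsto (fun z : ℝ => ∫ s in Ioi (0:ℝ), Real.exp (-s) * s ^ (μ - 1) *
      (z + s) ^ (-ν)) (𝓝[>] 0)
      (𝓝 (∫ s in Ioi (0:ℝ), Real.exp (-s) * s ^ (μ - 1) * s ^ (-ν))) := by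
    refine tendsto_integral_filter_of_dominated_convergence
      (fun s => (2 ^ (-ν) + 1) * (Real.exp (-s) * s ^ (μ - 1)) +
        (2 ^ (-ν) + 1) * (Real.exp (-s) * s ^ (μ - 1) * s ^ (-ν)))
      (Eventually.of_forall fun z => ?_) ?_
      (((Real.GammaIntegral_convergent hμ).const_mul _).add (hint.const_mul _)) ?_
    · exact Measurable.aestronglyMeasurable (by fun_prop)
    · filter_upwards [Ioo_mem_nhdsGT (zero_lt_one' ℝ)] with z hz
      refine ae_restrict_of_forall_mem measurableSet_Ioi fun s (hs : 0 < s) => ?_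
      have hz0 := hz.1
      have hz1 := hz.2
      rw [Real.norm_of_nonneg (by positivity)]
      have hA : 0 ≤ Real.exp (-s) * s ^ (μ - 1) := by positivity
      have h2 : (0 : ℝ) ≤ 2 ^ (-ν) := by positivity
      have hsν : 0 ≤ s ^ (-ν) := by positivity
      have hb : (z + s) ^ (-ν) ≤ (2 ^ (-ν) + 1) + (2 ^ (-ν) + 1) * s ^ (-ν) := by
        rcases le_total 0 ν with hν | hν
        · have : (z + s) ^ (-ν) ≤ s ^ (-ν) :=
            Real.rpow_le_rpow_of_nonpos hs (by linarith) (by linarith)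
          nlinarith [mul_nonneg h2 hsν]
        · rcases le_total s 1 with hs1 | hs1
          · have : (z + s) ^ (-ν) ≤ 2 ^ (-ν) :=
              Real.rpow_le_rpow (by positivity) (by linarith) (by linarith)
            nlinarith [mul_nonneg h2 hsν]
          · have : (z + s) ^ (-ν) ≤ (2 * s) ^ (-ν) :=
              Real.rpow_le_rpow (by positivity) (by linarith) (by linarith)
            rw [Real.mul_rpow zero_le_two hs.le] at this
            nlinarith
      calc _ ≤ _ := mul_le_mul_of_nonneg_left hb hA
        _ = _ := by ring
    · refine ae_restrict_of_forall_mem measurableSet_Ioi fun s (hs : 0 < s) => ?_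
      have : ContinuousAt (fun z : ℝ => Real.exp (-s) * s ^ (μ - 1) * (z + s) ^ (-ν)) 0 := by
        refine continuousAt_const.mul (ContinuousAt.rpow_const (by fun_prop) (Or.inl ?_))
        simpa using hs.ne'
      simpa [ContinuousAt] using this.tendsto.mono_left nhdsWithin_le_nhds
  have := key.const_mul (1 / Real.Gamma μ)
  rw [setIntegral_congr_fun measurableSet_Ioi hG, ← Real.Gamma_eq_integral (sub_pos.2 h)] at this
  rw [div_eq_inv_mul, ← one_div]
  refine this.congr' ?_
  filter_upwards [self_mem_nhdsWithin] with z hz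
  exact (rpow_mul_tricomiF μ ν hz).symm

/-- The substitution `t = exp (L u)` for integrals over `(0, ∞)`. -/
theorem integral_Ioi_eq_mul_integral_comp_exp_mul (g : ℝ → ℝ) {L : ℝ} (hL : 0 < L) :
    ∫ t in Ioi (0:ℝ), g t = L * ∫ u, Real.exp (L * u) * g (Real.exp (L * u)) := by
  have himage : (fun u : ℝ => Real.exp (L * u)) '' univ = Ioi 0 := by
    ext t
    simp only [image_univ, mem_range, mem_Ioi]
    refine ⟨fun ⟨u, hu⟩ => hu ▸ Real.exp_pos _, fun ht => ⟨Real.log t / L, ?_⟩⟩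
    rw [mul_div_cancel₀ _ hL.ne', Real.exp_log ht]
  have hd (u : ℝ) (_ : u ∈ univ) : HasDerivWithinAt (fun u : ℝ => Real.exp (L * u))
      (Real.exp (L * u) * L) univ u := by
    simpa using (((hasDerivAt_id u).const_mul L).exp).hasDerivWithinAt (s := univ)
  have hinj : InjOn (fun u : ℝ => Real.exp (L * u)) univ := fun x _ y _ hxy =>
    mul_left_cancel₀ hL.ne' (Real.exp_injective hxy)
  rw [← himage, integral_image_eq_integral_abs_deriv_smul MeasurableSet.univ hd hinj,
    setIntegral_univ, ← integral_const_mul]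
  congr 1 with u
  rw [abs_of_pos (by positivity), smul_eq_mul]
  ring

theorem integrable_exp_neg_mul_abs {c : ℝ} (hc : 0 < c) :
    Integrable fun u : ℝ => Real.exp (-(c * |u|)) := by
  rw [← integrableOn_univ, ← Iic_union_Ioi (a := (0 : ℝ)), integrableOn_union]
  constructor
  · refine (integrableOn_exp_mul_Iic hc 0).congr_fun (fun u (hu : u ≤ 0) => ?_) measurableSet_Iic
    simp [abs_of_nonpos hu]
  · refine (integrableOn_exp_mul_Ioi (neg_lt_zero.2 hc) 0).congr_fun
      (fun u (hu : 0 < u) => ?_) measurableSet_Ioi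
    simp [abs_of_pos hu]

/-- The integral defining `tricomiF μ μ z` in the logarithmic scale `t = z ^ (-u)`, where
`L = -log z`. -/
theorem tricomiF_self_exp_neg (μ : ℝ) {L : ℝ} (hL : 0 < L) :
    tricomiF μ μ (Real.exp (-L)) / L = (1 / Real.Gamma μ) *
      ∫ u, Real.exp (-Real.exp (L * (u - 1))) * (1 + Real.exp (-(L * u))) ^ (-μ) := by
  rw [tricomiF, integral_Ioi_eq_mul_integral_comp_exp_mul _ hL, mul_div_assoc,
    mul_div_cancel_left₀ _ hL.ne']
  congr 2 with u
  have h1 : Real.exp (L * (u - 1)) = Real.exp (L * u) * Real.exp (-L) := by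
    rw [← Real.exp_add]
    ring_nf
  have h2 : 1 + Real.exp (L * u) = Real.exp (L * u) * (1 + Real.exp (-(L * u))) := by
    rw [mul_add, ← Real.exp_add]
    simp [add_comm]
  have h3 : Real.exp (L * u) * Real.exp (L * u) ^ (μ - 1) * Real.exp (L * u) ^ (-μ) = 1 := by
    nth_rw 1 [← Real.rpow_one (Real.exp (L * u))]
    rw [← Real.rpow_add (Real.exp_pos _), ← Real.rpow_add (Real.exp_pos _)]
    simp
  rw [h1, h2, Real.mul_rpow (Real.exp_pos _).le (by positivity), neg_mul]
  linear_combination (Real.exp (-(Real.exp (L * u) * Real.exp (-L))) *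
    (1 + Real.exp (-(L * u))) ^ (-μ)) * h3

theorem exp_neg_exp_mul_one_add_exp_neg_rpow_le {μ L : ℝ} (hμ : 0 < μ) (hL : 1 ≤ L) (u : ℝ) :
    Real.exp (-Real.exp (L * (u - 1))) * (1 + Real.exp (-(L * u))) ^ (-μ) ≤
      Real.exp 1 * Real.exp (-(min μ 1 * |u|)) := by
  have hc0 : 0 < min μ 1 := lt_min hμ one_pos
  have hA : Real.exp (-Real.exp (L * (u - 1))) ≤ 1 :=
    Real.exp_le_one_iff.2 (neg_nonpos.2 (Real.exp_pos _).le)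
  have hB : (1 + Real.exp (-(L * u))) ^ (-μ) ≤ 1 :=
    Real.rpow_le_one_of_one_le_of_nonpos (by linarith [Real.exp_pos (-(L * u))]) (by linarith)
  have hB0 : 0 ≤ (1 + Real.exp (-(L * u))) ^ (-μ) := by positivity
  rw [← Real.exp_add]
  rcases le_total u 0 with hu | hu
  · have hB' : (1 + Real.exp (-(L * u))) ^ (-μ) ≤ Real.exp (μ * (L * u)) := by
      calc _ ≤ Real.exp (-(L * u)) ^ (-μ) :=
            Real.rpow_le_rpow_of_nonpos (Real.exp_pos _) (by linarith) (by linarith)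
        _ = _ := by rw [← Real.exp_mul]; ring_nf
    refine (mul_le_of_le_one_left hB0 hA).trans (hB'.trans (Real.exp_le_exp.2 ?_))
    rw [abs_of_nonpos hu]
    have h1 : min μ 1 ≤ μ * L := (min_le_left _ _).trans (by nlinarith)
    nlinarith
  · refine (mul_le_of_le_one_right (Real.exp_pos _).le hB).trans (Real.exp_le_exp.2 ?_)
    rw [abs_of_nonneg hu]
    have h1 : min μ 1 * u ≤ u := mul_le_of_le_one_left hu (min_le_right _ _)
    rcases le_total u 1 with hu1 | hu1
    · linarith [Real.exp_pos (L * (u - 1))]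
    · nlinarith [Real.add_one_le_exp (L * (u - 1))]

theorem tendsto_exp_neg_exp_mul_one_add_exp_neg_rpow {μ u : ℝ} (hμ : 0 < μ) (h0 : u ≠ 0)
    (h1 : u ≠ 1) :
    Tendsto (fun L => Real.exp (-Real.exp (L * (u - 1))) * (1 + Real.exp (-(L * u))) ^ (-μ))
      atTop (𝓝 ((Ioc (0 : ℝ) 1).indicator 1 u)) := by
  have hneg {a : ℝ} (ha : a < 0) : Tendsto (fun L : ℝ => Real.exp (L * a)) atTop (𝓝 0) :=
    Real.tendsto_exp_atBot.comp (tendsto_id.atTop_mul_const_of_neg ha)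
  have hpos {a : ℝ} (ha : 0 < a) : Tendsto (fun L : ℝ => Real.exp (L * a)) atTop atTop :=
    Real.tendsto_exp_atTop.comp (tendsto_id.atTop_mul_const ha)
  have hA (h : u < 1) : Tendsto (fun L => Real.exp (-Real.exp (L * (u - 1)))) atTop (𝓝 1) := by
    simpa using (hneg (sub_neg.2 h)).neg.rexp
  have hA' (h : 1 < u) : Tendsto (fun L => Real.exp (-Real.exp (L * (u - 1)))) atTop (𝓝 0) :=
    Real.tendsto_exp_neg_atTop_nhds_zero.comp (hpos (sub_pos.2 h))
  have hB (h : 0 < u) : Tendsto (fun L => (1 + Real.exp (-(L * u))) ^ (-μ)) atTop (𝓝 1) := by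
    have := ((hneg (neg_lt_zero.2 h)).const_add 1).rpow_const (p := -μ) (Or.inl (by simp))
    simpa using this
  have hB' (h : u < 0) : Tendsto (fun L => (1 + Real.exp (-(L * u))) ^ (-μ)) atTop (𝓝 0) := by
    have := (tendsto_rpow_neg_atTop hμ).comp
      (tendsto_atTop_add_const_left _ 1 (hpos (neg_pos.2 h)))
    simpa [Function.comp_def] using this
  rcases lt_or_gt_of_ne h0 with hu | hu
  · rw [indicator_of_notMem (fun h => h.1.not_gt hu)]
    simpa using (hA (by linarith)).mul (hB' hu)
  rcases lt_or_gt_of_ne h1 with hu1 | hu1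
  · rw [indicator_of_mem (mem_Ioc.2 ⟨hu, hu1.le⟩)]
    simpa using (hA hu1).mul (hB hu)
  · rw [indicator_of_notMem (fun h => h.2.not_gt hu1)]
    simpa using (hA' hu1).mul (hB hu)

theorem tendsto_tricomiF_self_div_neg_log {μ : ℝ} (hμ : 0 < μ) :
    Tendsto (fun z => tricomiF μ μ z / (-Real.log z)) (𝓝[>] 0) (𝓝 (1 / Real.Gamma μ)) := by
  have key : Tendsto (fun L : ℝ => ∫ u, Real.exp (-Real.exp (L * (u - 1))) *
      (1 + Real.exp (-(L * u))) ^ (-μ)) atTop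
      (𝓝 (∫ u : ℝ, (Ioc (0 : ℝ) 1).indicator 1 u)) := by
    refine tendsto_integral_filter_of_dominated_convergence
      (fun u => Real.exp 1 * Real.exp (-(min μ 1 * |u|))) (Eventually.of_forall fun L => ?_) ?_
      ((integrable_exp_neg_mul_abs (lt_min hμ one_pos)).const_mul _) ?_
    · exact Measurable.aestronglyMeasurable (by fun_prop)
    · filter_upwards [eventually_ge_atTop 1] with L hL
      refine Eventually.of_forall fun u => ?_
      rw [Real.norm_of_nonneg (by positivity)]
      exact exp_neg_exp_mul_one_add_exp_neg_rpow_le hμ hL u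
    · filter_upwards [volume.ae_ne 0, volume.ae_ne 1] with u h0 h1
      exact tendsto_exp_neg_exp_mul_one_add_exp_neg_rpow hμ h0 h1
  have hlog : Tendsto (fun z => -Real.log z) (𝓝[>] 0) atTop :=
    tendsto_neg_atBot_atTop.comp Real.tendsto_log_nhdsGT_zero
  have := (key.comp hlog).const_mul (1 / Real.Gamma μ)
  rw [integral_indicator_one measurableSet_Ioc] at this
  simp only [Real.volume_real_Ioc, sub_zero, zero_le_one, sup_of_le_left, mul_one] at this
  refine this.congr' ?_
  filter_upwards [self_mem_nhdsWithin, hlog.eventually_gt_atTop 0] with z (hz : 0 < z) hL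
  rw [Function.comp_apply, ← tricomiF_self_exp_neg μ hL, neg_neg, Real.exp_log hz]

end Tricomi

/-- Asymptotic behaviour of `f_{μ,ν}(z)` as `z → 0+`:
it tends to `Γ(ν-μ)/Γ(ν)` if `μ < ν`, is equivalent to `Γ(μ-ν)/Γ(μ) z^{ν-μ}` if `μ > ν`,
and is equivalent to `(-log z)/Γ(μ)` if `μ = ν`. -/
theorem tricomiF_asymptotics_zero (μ ν : ℝ) (hμ : 0 < μ) :
    (μ < ν → Tendsto (fun z => tricomiF μ ν z) (nhdsWithin 0 (Set.Ioi 0))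
        (nhds (Real.Gamma (ν - μ) / Real.Gamma ν))) ∧
    (ν < μ → Tendsto (fun z => z ^ (μ - ν) * tricomiF μ ν z) (nhdsWithin 0 (Set.Ioi 0))
        (nhds (Real.Gamma (μ - ν) / Real.Gamma μ))) ∧
    (μ = ν → Tendsto (fun z => tricomiF μ μ z / (-Real.log z)) (nhdsWithin 0 (Set.Ioi 0))
        (nhds (1 / Real.Gamma μ))) :=
  ⟨tendsto_tricomiF_of_lt hμ, tendsto_rpow_mul_tricomiF_of_lt hμ,
    fun _ => tendsto_tricomiF_self_div_neg_log hμ⟩
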